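/- arXiv:2310.13920 — 3 statements merged into one kernel-verified Lean document; each statement's English description precedes it below -/
import Mathlib

section
/- For every nondegenerate triangle K in ℝ², the space Σ(K) decomposes as the internal direct sum Σ(K) = airy(ℙ₅⁻(K)) ⊕ sym(ℙ₁(K;ℝ²)xᵀ), where sym(ℙ₁(K;ℝ²)xᵀ) := {x ↦ sym(p(x) xᵀ) : p ∈ ℙ₁(K;ℝ²)}; that is, both summands are contained in Σ(K), every τ ∈ Σ(K) can be written as τ = airy q + sym(p(x)xᵀ) with q ∈ ℙ₅⁻(K) and p ∈ ℙ₁(K;ℝ²), and the two summand subspaces intersect trivially. -/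
open MeasureTheory Matrix

noncomputable section

/-- Points of the plane ℝ². -/
abbrev V2 := Fin 2 → ℝ

/-- 2×2 real matrices. -/
abbrev Mat2 := Matrix (Fin 2) (Fin 2) ℝ

/-- The Euclidean dot product on ℝ². -/
def dot2 (x y : V2) : ℝ := x 0 * y 0 + x 1 * y 1

/-- The Euclidean norm on ℝ². -/
def norm2 (x : V2) : ℝ := Real.sqrt (dot2 x x)

/-- Rotation by -90 degrees, used to produce a unit normal from a unit tangent. -/
def rot (x : V2) : V2 := ![x 1, -(x 0)]

/-- The closed triangle with vertices `v 0, v 1, v 2`. -/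
def tri (v : Fin 3 → V2) : Set V2 := convexHull ℝ (Set.range v)

/-- `f` is (the function of) a real polynomial in two variables of total degree at most `k`. -/
def PolyDeg (k : ℕ) (f : V2 → ℝ) : Prop :=
  ∃ p : MvPolynomial (Fin 2) ℝ, p.totalDegree ≤ k ∧ ∀ x : V2, f x = MvPolynomial.eval x p

/-- matrix-valued polynomial fields of degree at most `k`, i.e. ℙ_k(·;𝕄). -/
def IsPolyMat (k : ℕ) (τ : V2 → Mat2) : Prop := ∀ i j, PolyDeg k fun x => τ x i j

/-- vector-valued polynomial fields of degree at most `k`, i.e. ℙ_k(·;ℝ²). -/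
def IsPolyVec (k : ℕ) (f : V2 → V2) : Prop := ∀ i, PolyDeg k fun x => f x i

/-- `f` agrees on `[0,1]` with a univariate polynomial of degree at most `k`
(used for restrictions to an edge, in an affine parametrization of the edge). -/
def IsPoly1 (k : ℕ) (f : ℝ → ℝ) : Prop :=
  ∃ p : Polynomial ℝ, p.natDegree ≤ k ∧ ∀ s ∈ Set.Icc (0:ℝ) 1, f s = Polynomial.eval s p

/-- Partial derivative in the `a`-th coordinate direction. -/
def pd (f : V2 → ℝ) (a : Fin 2) : V2 → ℝ := fun x => fderiv ℝ f x (Pi.single a 1)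

/-- Directional derivative of `f` in direction `w`. -/
def dirD (f : V2 → ℝ) (w : V2) (x : V2) : ℝ := fderiv ℝ f x w

/-- Row-wise divergence of a matrix-valued field. -/
def divMat (τ : V2 → Mat2) : V2 → V2 := fun x i => ∑ j, pd (fun y => τ y i j) j x

/-- The edge `e i` of the triangle, opposite to the vertex `v i`. -/
def edgeSet (v : Fin 3 → V2) (i : Fin 3) : Set V2 := segment ℝ (v (i+1)) (v (i+2))

/-- Affine parametrization of the edge `e i` over `[0,1]`. -/
def edgePt (v : Fin 3 → V2) (i : Fin 3) (s : ℝ) : V2 := v (i+1) + s • (v (i+2) - v (i+1))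

/-- The length of the edge `e i`. -/
def elen (v : Fin 3 → V2) (i : Fin 3) : ℝ := norm2 (v (i+2) - v (i+1))

/-- The unit tangent vector of the edge `e i`. -/
def tang (v : Fin 3 → V2) (i : Fin 3) : V2 := (elen v i)⁻¹ • (v (i+2) - v (i+1))

/-- The unit normal vector of the edge `e i`. -/
def nrml (v : Fin 3 → V2) (i : Fin 3) : V2 := rot (tang v i)

/-- The arclength integral over the edge `e i`. -/
def edgeInt (v : Fin 3 → V2) (i : Fin 3) (f : V2 → ℝ) : ℝ :=
  ∫ s in (0:ℝ)..1, f (edgePt v i s) * elen v i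

/-- The symmetric part of a matrix. -/
def symm2 (A : Mat2) : Mat2 := (2:ℝ)⁻¹ • (A + Aᵀ)

/-- The shape function space Σ(K) = {τ ∈ ℙ₃(K;𝕊) : div τ ∈ ℙ₁(K;ℝ²),
tᵀτn|ₑ ∈ ℙ₂(e) for each edge e}. -/
def SigmaSet (v : Fin 3 → V2) : Set (V2 → Mat2) :=
  {τ | IsPolyMat 3 τ ∧ (∀ x, (τ x).IsSymm) ∧ IsPolyVec 1 (divMat τ) ∧
    ∀ i : Fin 3, IsPoly1 2 fun s => dot2 (tang v i) ((τ (edgePt v i s)).mulVec (nrml v i))}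

/-- The Airy operator: (airy q)₁₁ = ∂²q/∂x₂², (airy q)₁₂ = (airy q)₂₁ = -∂²q/∂x₁∂x₂,
(airy q)₂₂ = ∂²q/∂x₁². -/
def airy (q : V2 → ℝ) : V2 → Mat2 := fun x =>
  Matrix.of ![![pd (pd q 1) 1 x, -(pd (pd q 1) 0 x)],
              ![-(pd (pd q 1) 0 x), pd (pd q 0) 0 x]]

/-- The shape function space ℙ₅⁻(K) of the Bell element:
quintic polynomials whose normal derivative on each edge has degree at most 3. -/
def P5m (v : Fin 3 → V2) : Set (V2 → ℝ) :=
  {q | PolyDeg 5 q ∧ ∀ i : Fin 3, IsPoly1 3 fun s => dirD q (nrml v i) (edgePt v i s)}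

namespace MvPolynomial

variable {σ R : Type*}

lemma coeff_X_mul_pderiv [CommSemiring R] (i : σ) (p : MvPolynomial σ R) (m : σ →₀ ℕ) :
    coeff m (X i * pderiv i p) = m i * coeff m p := by
  classical
  induction p using MvPolynomial.induction_on' with
  | monomial d r =>
    rw [X_mul_pderiv_monomial, coeff_smul, coeff_monomial, nsmul_eq_mul]
    split_ifs with h
    · rw [h]
    · simp
  | add p q hp hq => rw [map_add, mul_add, coeff_add, coeff_add, hp, hq, mul_add]

lemma totalDegree_pderiv_le [CommSemiring R] (i : σ) (p : MvPolynomial σ R) :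
    (pderiv i p).totalDegree ≤ p.totalDegree - 1 := by
  classical
  refine Finset.sup_le fun m hm => ?_
  rw [mem_support_iff, coeff_pderiv] at hm
  have h := le_totalDegree (mem_support_iff.2 (left_ne_zero_of_mul hm))
  rw [Finsupp.sum_add_index' (fun _ => rfl) (fun _ _ _ => rfl), Finsupp.sum_single_index rfl] at h
  omega

/-- **Poincaré lemma** for polynomial one-forms: a closed form `∑ fᵢ dxᵢ` is exact, and
integration raises the degree by at most one. -/
lemma exists_pderiv_eq [Field R] [CharZero R] [Fintype σ] {k : ℕ} (f : σ → MvPolynomial σ R)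
    (hf : ∀ i j, pderiv i (f j) = pderiv j (f i)) (hk : ∀ i, (f i).totalDegree ≤ k) :
    ∃ h : MvPolynomial σ R, h.totalDegree ≤ k + 1 ∧ ∀ i, pderiv i h = f i := by
  classical
  obtain ⟨w, hw⟩ : ∃ w : MvPolynomial σ R, w = ∑ i, X i * f i := ⟨_, rfl⟩
  have hwk : w.totalDegree ≤ k + 1 := by
    rw [hw]
    refine totalDegree_finsetSum_le fun i _ => (totalDegree_mul _ _).trans ?_
    rw [totalDegree_X, add_comm]
    exact Nat.add_le_add_right (hk i) 1
  set h : MvPolynomial σ R :=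
    ∑ d ∈ w.support, monomial d (coeff d w / ((∑ i, d i : ℕ) : R)) with hh
  have hcoeff (m : σ →₀ ℕ) : coeff m h = coeff m w / ((∑ i, m i : ℕ) : R) := by
    simp only [hh, coeff_sum, coeff_monomial, Finset.sum_ite_eq', mem_support_iff]
    split_ifs with hm
    · rfl
    · rw [not_not.1 hm, zero_div]
  refine ⟨h, ?_, fun j => ?_⟩
  · refine le_trans (Finset.sup_mono fun m hm => ?_) hwk
    rw [mem_support_iff, hcoeff] at hm
    rw [mem_support_iff]
    exact fun h0 => hm (by rw [h0, zero_div])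
  · have hwj : pderiv j w = f j + ∑ i, X i * pderiv i (f j) := by
      simp only [hw, map_sum, pderiv_mul, Finset.sum_add_distrib, hf j]
      congr 1
      rw [Finset.sum_eq_single j (fun i _ hij => by rw [pderiv_X_of_ne hij, zero_mul])
        (fun hj => absurd (Finset.mem_univ j) hj), pderiv_X_self, one_mul]
    ext m
    have hm := congrArg (coeff m) hwj
    rw [coeff_pderiv, coeff_add, coeff_sum] at hm
    simp only [coeff_X_mul_pderiv, ← Finset.sum_mul] at hm
    have hs : ((∑ i, (m + Finsupp.single j 1 : σ →₀ ℕ) i : ℕ) : R) = (∑ i, (m i : R)) + 1 := by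
      simp [Finset.sum_add_distrib, Finsupp.single_apply]
    have hne : (∑ i, (m i : R)) + 1 ≠ 0 := by
      rw [← Nat.cast_sum]
      exact Nat.cast_add_one_ne_zero _
    rw [coeff_pderiv, hcoeff, hs, div_mul_eq_mul_div, div_eq_iff hne, hm]
    ring

lemma eq_C_of_pderiv_eq_zero [Field R] [CharZero R] {p : MvPolynomial σ R}
    (hp : ∀ i, pderiv i p = 0) : p = C (coeff 0 p) := by
  classical
  ext m
  rw [coeff_C]
  split_ifs with hm
  · rw [hm]
  · obtain ⟨i, hi⟩ := Finsupp.ne_iff.1 (Ne.symm hm)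
    have h := coeff_X_mul_pderiv i p m
    rw [hp i, mul_zero, coeff_zero] at h
    exact (mul_eq_zero.1 h.symm).resolve_left (Nat.cast_ne_zero.2 hi)

lemma exists_affine_of_totalDegree_le_one [Field R] [CharZero R] [Fintype σ]
    {p : MvPolynomial σ R} (hp : p.totalDegree ≤ 1) :
    ∃ (a : R) (b : σ → R), p = C a + ∑ i, C (b i) * X i := by
  classical
  have hb (i : σ) : ∃ b, pderiv i p = C b :=
    ⟨_, totalDegree_eq_zero_iff_eq_C.1
      (Nat.le_zero.1 ((totalDegree_pderiv_le i p).trans (by omega)))⟩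
  choose b hb using hb
  refine ⟨_, b, eq_add_of_sub_eq (eq_C_of_pderiv_eq_zero (p := p - ∑ i, C (b i) * X i) fun i => ?_)⟩
  simp [hb, pderiv_X, Pi.single_apply]

lemma derivative_aeval [CommSemiring R] [Fintype σ] (g : σ → Polynomial R) (p : MvPolynomial σ R) :
    Polynomial.derivative (aeval g p) =
      ∑ i, aeval g (pderiv i p) * Polynomial.derivative (g i) := by
  classical
  induction p using MvPolynomial.induction_on with
  | C a => simp
  | add p q hp hq => simp only [map_add, hp, hq, add_mul, Finset.sum_add_distrib]
  | mul_X p n hp =>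
    simp only [map_mul, aeval_X, Polynomial.derivative_mul, hp, pderiv_mul, map_add, add_mul,
      Finset.sum_add_distrib, Finset.sum_mul]
    congr 1
    · exact Finset.sum_congr rfl fun i _ => by ring
    · rw [Finset.sum_eq_single n (fun i _ hin => by rw [pderiv_X_of_ne hin.symm]; simp)
        (fun hn => absurd (Finset.mem_univ n) hn), pderiv_X_self]
      simp

lemma hasFDerivAt_eval [Fintype σ] (p : MvPolynomial σ ℝ) (x : σ → ℝ) :
    HasFDerivAt (fun y => eval y p)
      (∑ i, eval x (pderiv i p) • (ContinuousLinearMap.proj i : (σ → ℝ) →L[ℝ] ℝ)) x := by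
  classical
  induction p using MvPolynomial.induction_on with
  | C a => simpa using hasFDerivAt_const a x
  | add p q hp hq =>
    simp only [map_add, add_smul, Finset.sum_add_distrib]
    exact hp.add hq
  | mul_X p n hp =>
    simp only [map_mul, eval_X]
    refine (hp.mul (hasFDerivAt_apply n x)).congr_fderiv ?_
    ext y
    simp only [pderiv_mul, pderiv_X, Pi.single_apply, map_add, map_mul, apply_ite (eval x), eval_X,
      map_zero, _root_.add_apply, _root_.sum_apply, _root_.smul_apply, ContinuousLinearMap.proj_apply, smul_eq_mul, mul_ite,
      mul_one, mul_zero, add_mul, ite_mul, zero_mul, Finset.sum_add_distrib, Finset.sum_ite_eq,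
      Finset.mem_univ, if_true, Finset.mul_sum]
    rw [add_comm]
    congr 1
    exact Finset.sum_congr rfl fun i _ => by ring

end MvPolynomial

lemma Polynomial.natDegree_le_succ_iff_derivative {R : Type*} [Field R] [CharZero R]
    (p : Polynomial R) (k : ℕ) :
    p.natDegree ≤ k + 1 ↔ (derivative p).natDegree ≤ k := by
  refine ⟨fun h => (natDegree_derivative_le p).trans (by omega), fun h => ?_⟩
  rcases Nat.eq_zero_or_pos p.natDegree with h0 | h0
  · omega
  · have := natDegree_eq_of_degree_eq_some (degree_derivative h0.ne')
    omega

open MvPolynomial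

lemma polyDeg_eval {k : ℕ} {p : MvPolynomial (Fin 2) ℝ} (hp : p.totalDegree ≤ k) :
    PolyDeg k fun x => eval x p :=
  ⟨p, hp, fun _ => rfl⟩

lemma PolyDeg.mono {k l : ℕ} {f : V2 → ℝ} (hf : PolyDeg k f) (h : k ≤ l) : PolyDeg l f :=
  let ⟨p, hp, hfp⟩ := hf
  ⟨p, hp.trans h, hfp⟩

lemma PolyDeg.add {k : ℕ} {f g : V2 → ℝ} (hf : PolyDeg k f) (hg : PolyDeg k g) :
    PolyDeg k fun x => f x + g x := by
  obtain ⟨p, hp, hfp⟩ := hf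
  obtain ⟨q, hq, hgq⟩ := hg
  exact ⟨p + q, (totalDegree_add p q).trans (max_le hp hq), fun x => by simp only [hfp, hgq, map_add]⟩

lemma PolyDeg.mul {k l : ℕ} {f g : V2 → ℝ} (hf : PolyDeg k f) (hg : PolyDeg l g) :
    PolyDeg (k + l) fun x => f x * g x := by
  obtain ⟨p, hp, hfp⟩ := hf
  obtain ⟨q, hq, hgq⟩ := hg
  exact ⟨p * q, (totalDegree_mul p q).trans (add_le_add hp hq), fun x => by simp only [hfp, hgq, map_mul]⟩

lemma polyDeg_const (c : ℝ) : PolyDeg 0 fun _ => c :=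
  ⟨C c, (totalDegree_C c).le, fun _ => (eval_C c).symm⟩

lemma polyDeg_coord (i : Fin 2) : PolyDeg 1 fun x => x i :=
  ⟨X i, (totalDegree_X i).le, fun _ => (eval_X i).symm⟩

lemma PolyDeg.const_mul {k : ℕ} {f : V2 → ℝ} (c : ℝ) (hf : PolyDeg k f) :
    PolyDeg k fun x => c * f x :=
  ((polyDeg_const c).mul hf).mono (zero_add k).le

lemma pd_eval (p : MvPolynomial (Fin 2) ℝ) (i : Fin 2) :
    pd (fun x => eval x p) i = fun x => eval x (pderiv i p) := by
  funext x
  rw [pd, (hasFDerivAt_eval p x).fderiv]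
  fin_cases i <;> simp

lemma dirD_eval (p : MvPolynomial (Fin 2) ℝ) (w x : V2) :
    dirD (fun x => eval x p) w x = eval x (C (w 0) * pderiv 0 p + C (w 1) * pderiv 1 p) := by
  rw [dirD, (hasFDerivAt_eval p x).fderiv]
  simp [mul_comm]

lemma PolyDeg.pd {k : ℕ} {f : V2 → ℝ} (hf : PolyDeg (k + 1) f) (i : Fin 2) :
    PolyDeg k (pd f i) := by
  obtain ⟨p, hp, hfp⟩ := hf
  obtain rfl : f = fun x => eval x p := funext hfp
  rw [pd_eval]
  exact polyDeg_eval ((totalDegree_pderiv_le i p).trans (by omega))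

/-- The restriction of a bivariate polynomial to an edge, as a polynomial in the edge parameter. -/
def edgeRestrict (v : Fin 3 → V2) (i : Fin 3) (p : MvPolynomial (Fin 2) ℝ) : Polynomial ℝ :=
  aeval (fun j => Polynomial.C (v (i + 1) j) +
    Polynomial.C (v (i + 2) j - v (i + 1) j) * Polynomial.X) p

lemma eval_edgeRestrict (v : Fin 3 → V2) (i : Fin 3) (p : MvPolynomial (Fin 2) ℝ) (s : ℝ) :
    (edgeRestrict v i p).eval s = eval (edgePt v i s) p := by
  induction p using MvPolynomial.induction_on with
  | C a => simp [edgeRestrict]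
  | add p q hp hq => simp only [edgeRestrict, map_add, Polynomial.eval_add] at *; rw [hp, hq]
  | mul_X p n hp =>
    simp only [edgeRestrict, map_mul, Polynomial.eval_mul] at *
    rw [hp]
    simp [edgePt, mul_comm]

lemma natDegree_edgeRestrict_le (v : Fin 3 → V2) (i : Fin 3) (p : MvPolynomial (Fin 2) ℝ) :
    (edgeRestrict v i p).natDegree ≤ p.totalDegree := by
  have h := aeval_natDegree_le p le_rfl (n := 1) (fun j => Polynomial.C (v (i + 1) j) +
    Polynomial.C (v (i + 2) j - v (i + 1) j) * Polynomial.X) fun j => by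
      rw [add_comm]; exact Polynomial.natDegree_linear_le
  rwa [mul_one] at h

lemma derivative_edgeRestrict (v : Fin 3 → V2) (i : Fin 3) (p : MvPolynomial (Fin 2) ℝ) :
    Polynomial.derivative (edgeRestrict v i p) = edgeRestrict v i
      (C (v (i + 2) 0 - v (i + 1) 0) * pderiv 0 p + C (v (i + 2) 1 - v (i + 1) 1) * pderiv 1 p) := by
  simp only [edgeRestrict, derivative_aeval, Fin.sum_univ_two, map_add, map_mul, aeval_C,
    Polynomial.derivative_C, Polynomial.derivative_C_mul,
    Polynomial.derivative_X, Polynomial.algebraMap_eq]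
  ring

lemma PolyDeg.isPoly1 {k : ℕ} {f : V2 → ℝ} (hf : PolyDeg k f) (v : Fin 3 → V2) (i : Fin 3) :
    IsPoly1 k fun s => f (edgePt v i s) := by
  obtain ⟨p, hp, hfp⟩ := hf
  exact ⟨edgeRestrict v i p, (natDegree_edgeRestrict_le v i p).trans hp,
    fun s _ => by simp only [eval_edgeRestrict, hfp]⟩

lemma IsPoly1.sub {k : ℕ} {f g : ℝ → ℝ} (hf : IsPoly1 k f) (hg : IsPoly1 k g) :
    IsPoly1 k fun s => f s - g s := by
  obtain ⟨p, hp, hfp⟩ := hf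
  obtain ⟨q, hq, hgq⟩ := hg
  exact ⟨p - q, (Polynomial.natDegree_sub_le p q).trans (max_le hp hq),
    fun s hs => by simp only [hfp s hs, hgq s hs, Polynomial.eval_sub]⟩

lemma isPoly1_eval_iff (k : ℕ) (p : Polynomial ℝ) :
    (IsPoly1 k fun s => p.eval s) ↔ p.natDegree ≤ k := by
  refine ⟨fun ⟨q, hq, h⟩ => ?_, fun h => ⟨p, h, fun _ _ => rfl⟩⟩
  rwa [Polynomial.eq_of_infinite_eval_eq p q ((Set.Icc_infinite zero_lt_one).mono h)]

lemma elen_ne_zero {v : Fin 3 → V2} (hv : AffineIndependent ℝ v) (i : Fin 3) : elen v i ≠ 0 := by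
  intro h
  have hnn : 0 ≤ dot2 (v (i + 2) - v (i + 1)) (v (i + 2) - v (i + 1)) :=
    add_nonneg (mul_self_nonneg _) (mul_self_nonneg _)
  have h0 := (Real.sqrt_eq_zero hnn).1 h
  simp only [dot2, Pi.sub_apply] at h0
  have hd : v (i + 2) = v (i + 1) := by
    ext j
    fin_cases j
    · show v (i + 2) 0 = v (i + 1) 0
      nlinarith [mul_self_nonneg (v (i + 2) 0 - v (i + 1) 0),
        mul_self_nonneg (v (i + 2) 1 - v (i + 1) 1)]
    · show v (i + 2) 1 = v (i + 1) 1
      nlinarith [mul_self_nonneg (v (i + 2) 0 - v (i + 1) 0),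
        mul_self_nonneg (v (i + 2) 1 - v (i + 1) 1)]
  have := hv.injective hd
  revert this
  fin_cases i <;> decide

lemma airy_eval (q : MvPolynomial (Fin 2) ℝ) (x : V2) :
    airy (fun x => eval x q) x =
      !![eval x (pderiv 1 (pderiv 1 q)), -eval x (pderiv 0 (pderiv 1 q));
        -eval x (pderiv 0 (pderiv 1 q)), eval x (pderiv 0 (pderiv 0 q))] := by
  simp only [airy, pd_eval]

lemma pderiv_comm (p : MvPolynomial (Fin 2) ℝ) (i j : Fin 2) :
    pderiv i (pderiv j p) = pderiv j (pderiv i p) := by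
  classical
  ext m
  simp only [coeff_pderiv, add_right_comm m]
  by_cases hij : i = j
  · rw [hij]
  · simp [hij, Ne.symm hij]
    ring

/-- Along an edge, `tᵀ (airy q) n` is minus the tangential derivative of `∂q/∂n`. -/
lemma isPoly1_normal_deriv_iff {v : Fin 3 → V2} (hv : AffineIndependent ℝ v) (k : ℕ)
    (q : MvPolynomial (Fin 2) ℝ) (i : Fin 3) :
    (IsPoly1 (k + 1) fun s => dirD (fun x => eval x q) (nrml v i) (edgePt v i s)) ↔
      IsPoly1 k fun s => dot2 (tang v i)
        ((airy (fun x => eval x q) (edgePt v i s)).mulVec (nrml v i)) := by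
  have hc : -(elen v i)⁻¹ ≠ 0 := neg_ne_zero.2 (inv_ne_zero (elen_ne_zero hv i))
  set D := C (nrml v i 0) * pderiv 0 q + C (nrml v i 1) * pderiv 1 q with hD
  have h1 : (fun s => dirD (fun x => eval x q) (nrml v i) (edgePt v i s)) =
      fun s => (edgeRestrict v i D).eval s := by
    funext s
    rw [dirD_eval, eval_edgeRestrict]
  have h2 : (fun s => dot2 (tang v i)
        ((airy (fun x => eval x q) (edgePt v i s)).mulVec (nrml v i))) =
      fun s => (Polynomial.C (-(elen v i)⁻¹) *
        Polynomial.derivative (edgeRestrict v i D)).eval s := by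
    funext s
    rw [derivative_edgeRestrict, Polynomial.eval_mul, eval_edgeRestrict, airy_eval, hD]
    simp only [map_add, pderiv_C_mul, map_mul, eval_C, Polynomial.eval_C, pderiv_comm q 1 0]
    simp [dot2, nrml, rot, tang, Matrix.mulVec, dotProduct, Fin.sum_univ_two]
    ring
  rw [h1, h2, isPoly1_eval_iff, isPoly1_eval_iff, Polynomial.natDegree_C_mul hc,
    Polynomial.natDegree_le_succ_iff_derivative]

lemma divMat_airy_eval (q : MvPolynomial (Fin 2) ℝ) :
    divMat (airy fun x => eval x q) = 0 := by
  have hneg (p : MvPolynomial (Fin 2) ℝ) (i : Fin 2) :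
      pd (fun x => -eval x p) i = fun x => -eval x (pderiv i p) := by
    simp only [← map_neg, pd_eval]
  funext x i
  fin_cases i <;> simp [divMat, airy_eval, hneg, pd_eval, pderiv_comm _ 1 0]

lemma airy_mem_sigmaSet {v : Fin 3 → V2} (hv : AffineIndependent ℝ v) {q : V2 → ℝ}
    (hq : q ∈ P5m v) : airy q ∈ SigmaSet v := by
  obtain ⟨⟨p, hp, hqp⟩, he⟩ := hq
  obtain rfl : q = fun x => eval x p := funext hqp
  have hpd (i j : Fin 2) : PolyDeg 3 fun x => eval x (pderiv i (pderiv j p)) := by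
    refine polyDeg_eval ((totalDegree_pderiv_le _ _).trans ?_)
    have := totalDegree_pderiv_le j p
    omega
  refine ⟨fun i j => ?_, fun x => ?_, fun i => ?_, fun i =>
    (isPoly1_normal_deriv_iff hv 2 p i).1 (he i)⟩
  · have h01 := (hpd 0 1).const_mul (-1)
    simp only [neg_one_mul] at h01
    fin_cases i <;> fin_cases j <;> simp [airy_eval, hpd, h01]
  · rw [airy_eval]
    ext i j
    fin_cases i <;> fin_cases j <;> rfl
  · rw [divMat_airy_eval]
    exact (polyDeg_const 0).mono zero_le_one

lemma symm2_vecMulVec_apply (p x : V2) (i j : Fin 2) :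
    symm2 (Matrix.vecMulVec p x) i j = 2⁻¹ * (p i * x j + p j * x i) := by
  simp [symm2, Matrix.vecMulVec_apply, mul_comm (x i)]

lemma symm2_mem_sigmaSet (v : Fin 3 → V2) {p : V2 → V2} (hp : IsPolyVec 1 p) :
    (fun x => symm2 (Matrix.vecMulVec (p x) x)) ∈ SigmaSet v := by
  have hent (i j : Fin 2) : PolyDeg 2 fun x => symm2 (Matrix.vecMulVec (p x) x) i j := by
    simp only [symm2_vecMulVec_apply]
    exact (((hp i).mul (polyDeg_coord j)).add ((hp j).mul (polyDeg_coord i))).const_mul _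
  refine ⟨fun i j => (hent i j).mono (by norm_num), fun x => ?_, fun i => ?_, fun i => ?_⟩
  · ext i j
    simp only [Matrix.transpose_apply, symm2_vecMulVec_apply]
    rw [add_comm]
  · simp only [divMat, Fin.sum_univ_two]
    exact ((hent i 0).pd 0).add ((hent i 1).pd 1)
  · refine PolyDeg.isPoly1 (f := fun x => dot2 (tang v i)
      ((symm2 (Matrix.vecMulVec (p x) x)).mulVec (nrml v i))) ?_ v i
    simp only [dot2, Matrix.mulVec, dotProduct, Fin.sum_univ_two, mul_comm _ (nrml v i _)]
    exact ((((hent 0 0).const_mul _).add ((hent 0 1).const_mul _)).const_mul _).add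
      ((((hent 1 0).const_mul _).add ((hent 1 1).const_mul _)).const_mul _)

lemma IsPolyVec.exists_affine {p : V2 → V2} (hp : IsPolyVec 1 p) :
    ∃ (a : Fin 2 → ℝ) (b : Fin 2 → Fin 2 → ℝ),
      ∀ x i, p x i = a i + b i 0 * x 0 + b i 1 * x 1 := by
  have h (i : Fin 2) : ∃ (a : ℝ) (b : Fin 2 → ℝ), ∀ x, p x i = a + b 0 * x 0 + b 1 * x 1 := by
    obtain ⟨P, hP, hpP⟩ := hp i
    obtain ⟨a, b, rfl⟩ := exists_affine_of_totalDegree_le_one hP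
    exact ⟨a, b, fun x => by simp [hpP, add_assoc]⟩
  choose a b h using h
  exact ⟨a, b, fun x i => h i x⟩

/-- The polynomial representing the `i j` entry of `sym (p xᵀ)` for `p x = a + b x`. -/
def symEntry (a : Fin 2 → ℝ) (b : Fin 2 → Fin 2 → ℝ) (i j : Fin 2) : MvPolynomial (Fin 2) ℝ :=
  C 2⁻¹ * ((C (a i) + C (b i 0) * X 0 + C (b i 1) * X 1) * X j +
    (C (a j) + C (b j 0) * X 0 + C (b j 1) * X 1) * X i)

lemma eval_symEntry {p : V2 → V2} {a : Fin 2 → ℝ} {b : Fin 2 → Fin 2 → ℝ}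
    (hp : ∀ x i, p x i = a i + b i 0 * x 0 + b i 1 * x 1) (x : V2) (i j : Fin 2) :
    eval x (symEntry a b i j) = symm2 (Matrix.vecMulVec (p x) x) i j := by
  simp [symm2_vecMulVec_apply, hp, symEntry]

lemma eval_div_symEntry (a : Fin 2 → ℝ) (b : Fin 2 → Fin 2 → ℝ) (x : V2) (i : Fin 2) :
    eval x (pderiv 0 (symEntry a b i 0) + pderiv 1 (symEntry a b i 1)) =
      2⁻¹ * (3 * a i + 4 * (b i 0 * x 0 + b i 1 * x 1) + (b 0 0 + b 1 1) * x i) := by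
  fin_cases i <;> simp [symEntry, pderiv_X] <;> ring

lemma eq_zero_of_airy_eq_symm2 {v : Fin 3 → V2} {q : V2 → ℝ} (hq : q ∈ P5m v) {p : V2 → V2}
    (hp : IsPolyVec 1 p) (h : airy q = fun x => symm2 (Matrix.vecMulVec (p x) x)) :
    airy q = 0 := by
  obtain ⟨⟨Q, -, hqQ⟩, -⟩ := hq
  obtain rfl : q = fun x => eval x Q := funext hqQ
  obtain ⟨a, b, hab⟩ := hp.exists_affine
  have hdiv (x : V2) (i : Fin 2) :
      2⁻¹ * (3 * a i + 4 * (b i 0 * x 0 + b i 1 * x 1) + (b 0 0 + b 1 1) * x i) = 0 := by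
    rw [← eval_div_symEntry, ← show divMat (airy fun x => eval x Q) x i = 0 by
      rw [divMat_airy_eval]; rfl, h]
    simp only [divMat, ← eval_symEntry hab, pd_eval, Fin.sum_univ_two, map_add]
  have h0 := hdiv ![0, 0]
  have h1 := hdiv ![1, 0]
  have h2 := hdiv ![0, 1]
  simp only [Fin.forall_fin_two, Matrix.cons_val_zero, Matrix.cons_val_one] at h0 h1 h2
  have hp0 (x : V2) : p x = 0 := by
    obtain ⟨h00, h01⟩ := h0
    obtain ⟨h10, h11⟩ := h1
    obtain ⟨h20, h21⟩ := h2
    have ha0 : a 0 = 0 := by linarith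
    have ha1 : a 1 = 0 := by linarith
    have hb00 : b 0 0 = 0 := by linarith
    have hb01 : b 0 1 = 0 := by linarith
    have hb10 : b 1 0 = 0 := by linarith
    have hb11 : b 1 1 = 0 := by linarith
    ext i
    rw [hab]
    fin_cases i <;> simp [*]
  rw [h]
  funext x
  ext i j
  simp [hp0, symm2]

/-- A symmetric divergence-free polynomial tensor is the Airy tensor of a polynomial. -/
lemma exists_airy_potential {k : ℕ} {a b c : MvPolynomial (Fin 2) ℝ}
    (ha : a.totalDegree ≤ k) (hb : b.totalDegree ≤ k) (hc : c.totalDegree ≤ k)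
    (h0 : pderiv 0 a + pderiv 1 b = 0) (h1 : pderiv 0 b + pderiv 1 c = 0) :
    ∃ q : MvPolynomial (Fin 2) ℝ, q.totalDegree ≤ k + 2 ∧ pderiv 1 (pderiv 1 q) = a ∧
      pderiv 0 (pderiv 1 q) = -b ∧ pderiv 0 (pderiv 0 q) = c := by
  obtain ⟨u, hu, hu'⟩ := exists_pderiv_eq ![c, -b] (k := k)
    (by simp [Fin.forall_fin_two, eq_neg_of_add_eq_zero_left h1])
    (by simp [Fin.forall_fin_two, hc, hb])
  obtain ⟨w, hw, hw'⟩ := exists_pderiv_eq ![-b, a] (k := k)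
    (by simp [Fin.forall_fin_two, eq_neg_of_add_eq_zero_left h0])
    (by simp [Fin.forall_fin_two, ha, hb])
  simp only [Fin.forall_fin_two, Matrix.cons_val_zero, Matrix.cons_val_one] at hu' hw'
  obtain ⟨q, hq, hq'⟩ := exists_pderiv_eq ![u, w] (k := k + 1)
    (by simp [Fin.forall_fin_two, hu', hw']) (by simp [Fin.forall_fin_two, hu, hw])
  simp only [Fin.forall_fin_two, Matrix.cons_val_zero, Matrix.cons_val_one] at hq'
  exact ⟨q, hq, by rw [hq'.2, hw'.2], by rw [hq'.2, hw'.1], by rw [hq'.1, hu'.1]⟩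

lemma exists_decomposition {v : Fin 3 → V2} (hv : AffineIndependent ℝ v) {τ : V2 → Mat2}
    (hτ : τ ∈ SigmaSet v) : ∃ q ∈ P5m v, ∃ p : V2 → V2, IsPolyVec 1 p ∧
      τ = fun x => airy q x + symm2 (Matrix.vecMulVec (p x) x) := by
  obtain ⟨hpoly, hsymm, hdiv, hedge⟩ := hτ
  choose T hT hτT using hpoly
  obtain ⟨f, g, hfg⟩ := hdiv.exists_affine
  set a : Fin 2 → ℝ := fun i => 2 / 3 * f i with ha
  set b : Fin 2 → Fin 2 → ℝ :=
    fun i j => 2⁻¹ * (g i j - if i = j then (g 0 0 + g 1 1) / 6 else 0) with hb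
  set p : V2 → V2 := fun x i => a i + b i 0 * x 0 + b i 1 * x 1 with hp
  have hS := eval_symEntry (p := p) (a := a) (b := b) fun _ _ => rfl
  have hpp : IsPolyVec 1 p := fun i =>
    (((polyDeg_const _).mono zero_le_one).add ((polyDeg_coord 0).const_mul _)).add
      ((polyDeg_coord 1).const_mul _)
  have hSσ := symm2_mem_sigmaSet v hpp
  have hSdeg (i j : Fin 2) : (symEntry a b i j).totalDegree ≤ 3 := by
    obtain ⟨P, hP, hPe⟩ := hSσ.1 i j
    rwa [MvPolynomial.funext fun x => (hS x i j).trans (hPe x)]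
  have hTS (i : Fin 2) : pderiv 0 (T i 0 - symEntry a b i 0) +
      pderiv 1 (T i 1 - symEntry a b i 1) = 0 := by
    refine MvPolynomial.funext fun x => ?_
    have h1 := eval_div_symEntry a b x i
    have h2 := hfg x i
    simp only [divMat, hτT, pd_eval, Fin.sum_univ_two] at h2
    simp only [map_add, map_sub, map_zero] at h1 ⊢
    have h3 : f i + g i 0 * x 0 + g i 1 * x 1 =
        2⁻¹ * (3 * a i + 4 * (b i 0 * x 0 + b i 1 * x 1) + (b 0 0 + b 1 1) * x i) := by
      fin_cases i <;> simp [ha, hb] <;> ring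
    linarith
  have hT01 : T 1 0 = T 0 1 := MvPolynomial.funext fun x => by
    rw [← hτT, ← hτT]; exact (hsymm x).apply 0 1
  have hS01 : symEntry a b 1 0 = symEntry a b 0 1 := by
    rw [symEntry, symEntry, add_comm]
  have hdeg (i j : Fin 2) : (T i j - symEntry a b i j).totalDegree ≤ 3 :=
    (totalDegree_sub _ _).trans (max_le (hT i j) (hSdeg i j))
  have hTS1 := hTS 1
  rw [hT01, hS01] at hTS1
  obtain ⟨q, hq, hq11, hq01, hq00⟩ :=
    exists_airy_potential (hdeg 0 0) (hdeg 0 1) (hdeg 1 1) (hTS 0) hTS1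
  have hairy (x : V2) : airy (fun x => eval x q) x = τ x - symm2 (Matrix.vecMulVec (p x) x) := by
    rw [airy_eval, hq11, hq01, hq00]
    ext i j
    rw [Matrix.sub_apply]
    fin_cases i <;> fin_cases j <;> simp [hτT, ← hS, hT01, hS01]
  refine ⟨fun x => eval x q, ⟨polyDeg_eval hq, fun i => ?_⟩, p, hpp, ?_⟩
  · rw [isPoly1_normal_deriv_iff hv 2]
    convert (hedge i).sub (hSσ.2.2.2 i) using 2 with s
    rw [hairy, Matrix.sub_mulVec]
    simp only [dot2, Pi.sub_apply]
    ring
  · funext x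
    rw [hairy, sub_add_cancel]

/-- for every nondegenerate triangle K,
Σ(K) = airy(ℙ₅⁻(K)) ⊕ sym(ℙ₁(K;ℝ²)xᵀ) as an internal direct sum. -/
theorem statement0 (v : Fin 3 → V2) (hv : AffineIndependent ℝ v) :
    -- both summands are contained in Σ(K)
    (∀ q ∈ P5m v, airy q ∈ SigmaSet v) ∧
    (∀ p : V2 → V2, IsPolyVec 1 p →
      (fun x => symm2 (Matrix.vecMulVec (p x) x)) ∈ SigmaSet v) ∧
    -- every τ ∈ Σ(K) decomposes as τ = airy q + sym(p(x)xᵀ)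
    (∀ τ ∈ SigmaSet v, ∃ q ∈ P5m v, ∃ p : V2 → V2, IsPolyVec 1 p ∧
      τ = fun x => airy q x + symm2 (Matrix.vecMulVec (p x) x)) ∧
    -- the two summand subspaces intersect trivially
    (∀ τ : V2 → Mat2, (∃ q ∈ P5m v, τ = airy q) →
      (∃ p : V2 → V2, IsPolyVec 1 p ∧ τ = fun x => symm2 (Matrix.vecMulVec (p x) x)) →
      τ = 0) := by
  exact ⟨fun q hq => airy_mem_sigmaSet hv hq, fun p hp => symm2_mem_sigmaSet v hp,
    fun τ hτ => exists_decomposition hv hτ,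
    fun τ ⟨q, hq, hτq⟩ ⟨p, hp, hτp⟩ =>
      hτq.trans (eq_zero_of_airy_eq_symm2 hq hp (hτq.symm.trans hτp))⟩
end
end

section
/- For every nondegenerate triangle K in ℝ² and each cyclic permutation (i,j,k) of (0,1,2), the field ψ_i satisfies the trace identities: ψ_i(x) n_j = 0 for every x ∈ e_j; ψ_i(x) n_k = 0 for every x ∈ e_k; t_iᵀ ψ_i(x) n_i = 0 for every x ∈ e_i; and n_iᵀ ψ_i(x) n_i = 10 λ_j(x) λ_k(x)² for every x ∈ e_i. -/
open MeasureTheory Matrix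

noncomputable section

/-- c_{ab} = ∇λ_a · ∇λ_b, where `g a` is the (constant) gradient of λ_a. -/
def cc (g : Fin 3 → V2) (a b : Fin 3) : ℝ := dot2 (g a) (g b)

/-- t_{ab} := v_b − v_a. -/
def tv (v : Fin 3 → V2) (a b : Fin 3) : V2 := v b - v a

/-- Outer product u ⊗ u. -/
def ot (u : V2) : Mat2 := Matrix.vecMulVec u u

/-- The matrix field ψ_i of Lemma 2.3, for the cyclic permutation (i, i+1, i+2). -/
def psi (v : Fin 3 → V2) (lam : Fin 3 → V2 → ℝ) (g : Fin 3 → V2) (i : Fin 3) :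
    V2 → Mat2 := fun x =>
  (-10 * cc g i (i+2) * lam (i+1) x * lam (i+2) x ^ 2) • ot (tv v (i+2) i)
  + (-10 * cc g i (i+1) * (lam (i+2) x + lam i x) * lam (i+1) x * lam (i+2) x) • ot (tv v i (i+1))
  + (((6 * cc g i (i+1) - 9 * cc g i (i+2)) * lam (i+1) x
      + (9 * cc g i (i+1) - 6 * cc g i (i+2)) * lam (i+2) x)
      * lam (i+1) x * lam (i+2) x) • ot (tv v (i+1) (i+2))
  + (((6 * cc g i (i+1) - 9 * cc g i (i+2)) * lam (i+1) x
      + (2 * cc g i (i+2) - 3 * cc g i (i+1)) * lam (i+2) x)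
      * lam (i+2) x * lam i x) • ot (tv v (i+2) i)
  + (((3 * cc g i (i+2) - 2 * cc g i (i+1)) * lam (i+1) x
      + (9 * cc g i (i+1) - 6 * cc g i (i+2)) * lam (i+2) x)
      * lam i x * lam (i+1) x) • ot (tv v i (i+1))

theorem ot_mulVec_rot (u : V2) : (ot u).mulVec (rot u) = 0 := by
  ext a
  simp [ot, rot, Matrix.mulVec, dotProduct, Fin.sum_univ_two, Matrix.vecMulVec_apply]
  ring

theorem dot2_rot_self (u : V2) : dot2 u (rot u) = 0 := by
  simp [dot2, rot]
  ring

theorem dot2_ot_mulVec (u w z : V2) : dot2 w ((ot u).mulVec z) = dot2 u w * dot2 u z := by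
  simp [ot, dot2, Matrix.mulVec, dotProduct, Fin.sum_univ_two, Matrix.vecMulVec_apply]
  ring

theorem dot2_add_right (w x y : V2) : dot2 w (x + y) = dot2 w x + dot2 w y := by
  simp [dot2]
  ring

theorem dot2_smul_right (c : ℝ) (w x : V2) : dot2 w (c • x) = c * dot2 w x := by
  simp [dot2]
  ring

theorem rot_smul (c : ℝ) (x : V2) : rot (c • x) = c • rot x := by
  ext a
  fin_cases a <;> simp [rot]

theorem dot2_self_nonneg (x : V2) : 0 ≤ dot2 x x :=
  add_nonneg (mul_self_nonneg _) (mul_self_nonneg _)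

/-- An affine function vanishing at two points vanishes on the segment joining them. -/
theorem affine_eq_zero_of_mem_segment {f : V2 → ℝ} {w a b x : V2}
    (hf : ∀ y, f y = dot2 w y + f 0) (ha : f a = 0) (hb : f b = 0)
    (hx : x ∈ segment ℝ a b) : f x = 0 := by
  obtain ⟨s, t, -, -, hst, rfl⟩ := hx
  rw [hf] at ha hb
  rw [hf, dot2_add_right, dot2_smul_right, dot2_smul_right]
  linear_combination s * ha + t * hb - f 0 * hst

/-- The gradients of the barycentric coordinates of the triangle `p, q, r` at `q` and `r`, together
with the nonvanishing of the determinant of the edge vectors. -/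
theorem barycentric_gradient_formula {p q r gj gk : V2}
    (hjq : dot2 gj (q - p) = 1) (hjr : dot2 gj (r - p) = 0)
    (hkq : dot2 gk (q - p) = 0) (hkr : dot2 gk (r - p) = 1) :
    ∃ D : ℝ, D ≠ 0 ∧ D = (q 0 - p 0) * (r 1 - p 1) - (q 1 - p 1) * (r 0 - p 0) ∧
      gj 0 = (r 1 - p 1) / D ∧ gj 1 = -(r 0 - p 0) / D ∧
      gk 0 = -(q 1 - p 1) / D ∧ gk 1 = (q 0 - p 0) / D := by
  simp only [dot2, Pi.sub_apply] at hjq hjr hkq hkr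
  have hD : (q 0 - p 0) * (r 1 - p 1) - (q 1 - p 1) * (r 0 - p 0) ≠ 0 := by
    intro h
    have h1 : ((q 0 - p 0) * (r 1 - p 1) - (q 1 - p 1) * (r 0 - p 0)) *
        (gj 0 * gk 1 - gj 1 * gk 0) = 1 := by
      linear_combination hjq * (gk 0 * (r 0 - p 0) + gk 1 * (r 1 - p 1)) + hkr -
        hjr * (gk 0 * (q 0 - p 0) + gk 1 * (q 1 - p 1))
    simp [h] at h1
  refine ⟨_, hD, rfl, ?_, ?_, ?_, ?_⟩ <;> rw [eq_div_iff hD]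
  · linear_combination (r 1 - p 1) * hjq - (q 1 - p 1) * hjr
  · linear_combination -(r 0 - p 0) * hjq + (q 0 - p 0) * hjr
  · linear_combination (r 1 - p 1) * hkq - (q 1 - p 1) * hkr
  · linear_combination -(r 0 - p 0) * hkq + (q 0 - p 0) * hkr

theorem barycentric_gradient_sum {p q r gi gj gk : V2}
    (hiq : dot2 gi (q - p) = -1) (hir : dot2 gi (r - p) = -1)
    (hjq : dot2 gj (q - p) = 1) (hjr : dot2 gj (r - p) = 0)
    (hkq : dot2 gk (q - p) = 0) (hkr : dot2 gk (r - p) = 1) :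
    gi = -(gj + gk) := by
  obtain ⟨D, hD, hDeq, h1, h2, h3, h4⟩ := barycentric_gradient_formula hjq hjr hkq hkr
  simp only [dot2, Pi.sub_apply] at hiq hir
  have h5 : gi 0 = -(gj 0 + gk 0) := by
    rw [h1, h3]
    field_simp
    rw [hDeq]
    linear_combination (r 1 - p 1) * hiq - (q 1 - p 1) * hir
  have h6 : gi 1 = -(gj 1 + gk 1) := by
    rw [h2, h4]
    field_simp
    rw [hDeq]
    linear_combination -(r 0 - p 0) * hiq + (q 0 - p 0) * hir
  ext a
  fin_cases a <;> simp [h5, h6]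

theorem gradient_tangential_normal {p q r gi gj gk : V2}
    (hiq : dot2 gi (q - p) = -1) (hir : dot2 gi (r - p) = -1)
    (hjq : dot2 gj (q - p) = 1) (hjr : dot2 gj (r - p) = 0)
    (hkq : dot2 gk (q - p) = 0) (hkr : dot2 gk (r - p) = 1) :
    dot2 gi gk * (dot2 (p - r) (r - q) * dot2 (p - r) (rot (r - q))) +
      dot2 gi gj * (dot2 (q - p) (r - q) * dot2 (q - p) (rot (r - q))) = 0 := by
  obtain rfl := barycentric_gradient_sum hiq hir hjq hjr hkq hkr
  obtain ⟨D, hD, -, h1, h2, h3, h4⟩ := barycentric_gradient_formula hjq hjr hkq hkr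
  simp only [dot2, rot, Pi.sub_apply, Pi.neg_apply, Pi.add_apply, Matrix.cons_val_zero,
    Matrix.cons_val_one, h1, h2, h3, h4]
  field_simp
  ring

theorem gradient_normal_normal {p q r gi gj gk : V2}
    (hiq : dot2 gi (q - p) = -1) (hir : dot2 gi (r - p) = -1)
    (hjq : dot2 gj (q - p) = 1) (hjr : dot2 gj (r - p) = 0)
    (hkq : dot2 gk (q - p) = 0) (hkr : dot2 gk (r - p) = 1) :
    dot2 gi gk * dot2 (p - r) (rot (r - q)) ^ 2 + dot2 gi gj * dot2 (q - p) (rot (r - q)) ^ 2 =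
      -dot2 (r - q) (r - q) := by
  obtain rfl := barycentric_gradient_sum hiq hir hjq hjr hkq hkr
  obtain ⟨D, hD, hDeq, h1, h2, h3, h4⟩ := barycentric_gradient_formula hjq hjr hkq hkr
  simp only [dot2, rot, Pi.sub_apply, Pi.neg_apply, Pi.add_apply, Matrix.cons_val_zero,
    Matrix.cons_val_one, h1, h2, h3, h4]
  field_simp
  rw [hDeq]
  ring

/-- trace identities for ψ_i, with (i, j, k) = (i, i+1, i+2) a cyclic
permutation of (0,1,2): ψ_i n_j = 0 on e_j, ψ_i n_k = 0 on e_k, tᵀψ_i n = 0 on e_i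
and nᵀψ_i n = 10 λ_j λ_k² on e_i. -/
theorem statement3 (v : Fin 3 → V2) (hv : AffineIndependent ℝ v)
    (lam : Fin 3 → V2 → ℝ) (g : Fin 3 → V2)
    (hlin : ∀ ℓ x, lam ℓ x = dot2 (g ℓ) x + lam ℓ 0)
    (hvert : ∀ ℓ m, lam ℓ (v m) = if ℓ = m then 1 else 0)
    (i : Fin 3) :
    (∀ x ∈ edgeSet v (i+1), (psi v lam g i x).mulVec (nrml v (i+1)) = 0) ∧
    (∀ x ∈ edgeSet v (i+2), (psi v lam g i x).mulVec (nrml v (i+2)) = 0) ∧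
    (∀ x ∈ edgeSet v i, dot2 (tang v i) ((psi v lam g i x).mulVec (nrml v i)) = 0) ∧
    (∀ x ∈ edgeSet v i, dot2 (nrml v i) ((psi v lam g i x).mulVec (nrml v i))
        = 10 * lam (i+1) x * lam (i+2) x ^ 2) := by
  have e1 : i + 1 + 1 = i + 2 := by fin_cases i <;> rfl
  have e2 : i + 1 + 2 = i := by fin_cases i <;> rfl
  have e3 : i + 2 + 1 = i := by fin_cases i <;> rfl
  have e4 : i + 2 + 2 = i + 1 := by fin_cases i <;> rfl
  have n1 : i ≠ i + 1 := by fin_cases i <;> decide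
  have n2 : i ≠ i + 2 := by fin_cases i <;> decide
  have n3 : i + 1 ≠ i + 2 := by fin_cases i <;> decide
  have hvanish : ∀ ℓ a b x, ℓ ≠ a → ℓ ≠ b → x ∈ segment ℝ (v a) (v b) → lam ℓ x = 0 := by
    intro ℓ a b x ha hb hx
    exact affine_eq_zero_of_mem_segment (hlin ℓ) (by simp [hvert, ha]) (by simp [hvert, hb]) hx
  have hdiff : ∀ ℓ a b, dot2 (g ℓ) (v a - v b) =
      (if ℓ = a then 1 else 0) - (if ℓ = b then 1 else 0) := by
    intro ℓ a b
    rw [← hvert ℓ a, ← hvert ℓ b, hlin ℓ (v a), hlin ℓ (v b)]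
    simp only [dot2, Pi.sub_apply]
    ring
  have hiq : dot2 (g i) (v (i+1) - v i) = -1 := by simp [hdiff, n1]
  have hir : dot2 (g i) (v (i+2) - v i) = -1 := by simp [hdiff, n2]
  have hjq : dot2 (g (i+1)) (v (i+1) - v i) = 1 := by simp [hdiff, n1.symm]
  have hjr : dot2 (g (i+1)) (v (i+2) - v i) = 0 := by simp [hdiff, n1.symm, n3]
  have hkq : dot2 (g (i+2)) (v (i+1) - v i) = 0 := by simp [hdiff, n2.symm, n3.symm]
  have hkr : dot2 (g (i+2)) (v (i+2) - v i) = 1 := by simp [hdiff, n2.symm]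
  have hjk : dot2 (g (i+1)) (v (i+2) - v (i+1)) = -1 := by simp [hdiff, n3]
  have hpsi : ∀ x, lam i x = 0 → psi v lam g i x =
      (-10 * lam (i+1) x * lam (i+2) x ^ 2) •
        (cc g i (i+2) • ot (tv v (i+2) i) + cc g i (i+1) • ot (tv v i (i+1))) +
      (((6 * cc g i (i+1) - 9 * cc g i (i+2)) * lam (i+1) x
        + (9 * cc g i (i+1) - 6 * cc g i (i+2)) * lam (i+2) x)
        * lam (i+1) x * lam (i+2) x) • ot (v (i+2) - v (i+1)) := by
    intro x hx
    simp only [psi, hx, tv]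
    module
  refine ⟨fun x hx => ?_, fun x hx => ?_, fun x hx => ?_, fun x hx => ?_⟩
  · rw [edgeSet, e1, e2] at hx
    have h0 : lam (i+1) x = 0 := hvanish (i+1) _ _ x n3 n1.symm hx
    simp only [psi, h0, nrml, tang, e1, e2, tv, rot_smul, Matrix.mulVec_smul, Matrix.smul_mulVec,
      ot_mulVec_rot, mul_zero, zero_mul, smul_zero, zero_smul, add_zero, zero_add]
  · rw [edgeSet, e3, e4] at hx
    have h0 : lam (i+2) x = 0 := hvanish (i+2) _ _ x n2.symm n3.symm hx
    simp only [psi, h0, nrml, tang, e3, e4, tv, rot_smul, Matrix.mulVec_smul, Matrix.smul_mulVec,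
      ot_mulVec_rot, mul_zero, zero_mul, smul_zero, zero_smul, add_zero, zero_add,
      ne_eq, OfNat.ofNat_ne_zero, not_false_eq_true, zero_pow]
  · have key := gradient_tangential_normal hiq hir hjq hjr hkq hkr
    rw [hpsi x (hvanish i _ _ x n1 n2 hx)]
    simp only [nrml, tang, tv, cc, Matrix.add_mulVec, Matrix.smul_mulVec, dot2_add_right,
      dot2_smul_right, dot2_ot_mulVec, rot_smul, dot2_rot_self]
    linear_combination -10 * lam (i+1) x * lam (i+2) x ^ 2 * (elen v i)⁻¹ ^ 2 * key
  · have key := gradient_normal_normal hiq hir hjq hjr hkq hkr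
    have hL : elen v i ^ 2 = dot2 (v (i+2) - v (i+1)) (v (i+2) - v (i+1)) :=
      Real.sq_sqrt (dot2_self_nonneg _)
    have hL0 : elen v i ≠ 0 := by
      intro h
      rw [h] at hL
      simp only [dot2] at hL hjk
      have h0 : (v (i+2) - v (i+1)) 0 = 0 := by nlinarith
      have h1 : (v (i+2) - v (i+1)) 1 = 0 := by nlinarith
      simp [h0, h1] at hjk
    have hunit : (elen v i)⁻¹ ^ 2 * elen v i ^ 2 = 1 := by field_simp
    rw [← hL] at key
    rw [hpsi x (hvanish i _ _ x n1 n2 hx)]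
    simp only [nrml, tang, tv, cc, Matrix.add_mulVec, Matrix.smul_mulVec, dot2_add_right,
      dot2_smul_right, dot2_ot_mulVec, rot_smul, dot2_rot_self]
    linear_combination -10 * lam (i+1) x * lam (i+2) x ^ 2 * (elen v i)⁻¹ ^ 2 * key +
      10 * lam (i+1) x * lam (i+2) x ^ 2 * hunit
end
end

section
/- For every nondegenerate triangle K in ℝ² and each cyclic permutation (i,j,k) of (0,1,2), the fields φ_{i,1} and φ_{i,2} satisfy the edge-moment identities: (1/|e_i|)∫_{e_i} (n_iᵀ φ_{i,1} n_i) λ_j ds = 1, (1/|e_i|)∫_{e_i} (n_iᵀ φ_{i,1} n_i) λ_k ds = 0, (1/|e_i|)∫_{e_i} (n_iᵀ φ_{i,2} n_i) λ_j ds = 0, and (1/|e_i|)∫_{e_i} (n_iᵀ φ_{i,2} n_i) λ_k ds = 1. -/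
open MeasureTheory Matrix

noncomputable section

/-- φ_{i,1} := 36 λ_j λ_k n_i ⊗ n_i − 6 ψ_i. -/
def phi1 (v : Fin 3 → V2) (lam : Fin 3 → V2 → ℝ) (g : Fin 3 → V2) (i : Fin 3) :
    V2 → Mat2 := fun x =>
  (36 * lam (i+1) x * lam (i+2) x) • ot (nrml v i) - (6:ℝ) • psi v lam g i x

/-- φ_{i,2} := −24 λ_j λ_k n_i ⊗ n_i + 6 ψ_i. -/
def phi2 (v : Fin 3 → V2) (lam : Fin 3 → V2 → ℝ) (g : Fin 3 → V2) (i : Fin 3) :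
    V2 → Mat2 := fun x =>
  (-24 * lam (i+1) x * lam (i+2) x) • ot (nrml v i) + (6:ℝ) • psi v lam g i x

theorem dot2_mulVec_ot (n u : V2) : dot2 n ((ot u).mulVec n) = dot2 n u ^ 2 := by
  simp only [dot2, ot, mulVec, dotProduct, vecMulVec_apply, Fin.sum_univ_two]
  ring

theorem dot2_mulVec_smul (n : V2) (c : ℝ) (A : Mat2) :
    dot2 n ((c • A).mulVec n) = c * dot2 n (A.mulVec n) := by
  simp only [dot2, smul_mulVec, Pi.smul_apply, smul_eq_mul]
  ring

theorem dot2_mulVec_add (n : V2) (A B : Mat2) :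
    dot2 n ((A + B).mulVec n) = dot2 n (A.mulVec n) + dot2 n (B.mulVec n) := by
  simp only [dot2, add_mulVec, Pi.add_apply]
  ring

theorem dot2_mulVec_sub (n : V2) (A B : Mat2) :
    dot2 n ((A - B).mulVec n) = dot2 n (A.mulVec n) - dot2 n (B.mulVec n) := by
  simp only [dot2, sub_mulVec, Pi.sub_apply]
  ring

/-- If `g` is orthogonal to `d ≠ 0` and `g · a = 1`, then `|g|² (rot d · a)² = |d|²`. -/
theorem dot2_self_mul_sq_dot2_rot {g d a : V2} (hgd : dot2 g d = 0) (hga : dot2 g a = 1)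
    (hd : dot2 d d ≠ 0) : dot2 g g * dot2 (rot d) a ^ 2 = dot2 d d := by
  have hcross : dot2 d d = dot2 (rot d) g * dot2 (rot d) a := by
    simp only [dot2, rot, cons_val_zero, cons_val_one] at *
    linear_combination (-(d 0 ^ 2 + d 1 ^ 2)) * hga + (d 0 * a 0 + d 1 * a 1) * hgd
  have hgg : dot2 g g * dot2 d d = dot2 (rot d) g ^ 2 := by
    simp only [dot2, rot, cons_val_zero, cons_val_one] at *
    linear_combination (g 0 * d 0 + g 1 * d 1) * hgd
  apply mul_right_cancel₀ hd
  linear_combination dot2 (rot d) a ^ 2 * hgg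
    - (dot2 d d + dot2 (rot d) g * dot2 (rot d) a) * hcross

/-- A vector orthogonal to two vectors `d`, `a` with `rot d · a ≠ 0` is orthogonal to every vector. -/
theorem dot2_eq_zero_of_orthogonal {G d a : V2} (hGd : dot2 G d = 0) (hGa : dot2 G a = 0)
    (hda : dot2 (rot d) a ≠ 0) (g : V2) : dot2 G g = 0 := by
  apply mul_right_cancel₀ hda
  simp only [dot2, rot, cons_val_zero, cons_val_one] at *
  linear_combination (d 1 * g 0 - d 0 * g 1) * hGa + (a 0 * g 1 - a 1 * g 0) * hGd

section Triangle

variable {v : Fin 3 → V2} {lam : Fin 3 → V2 → ℝ} {g : Fin 3 → V2}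

theorem dot2_grad_sub (hlin : ∀ ℓ x, lam ℓ x = dot2 (g ℓ) x + lam ℓ 0) (ℓ : Fin 3) (x y : V2) :
    dot2 (g ℓ) (x - y) = lam ℓ x - lam ℓ y := by
  rw [hlin ℓ x, hlin ℓ y]
  simp only [dot2, Pi.sub_apply]
  ring

theorem lam_edgePt (hlin : ∀ ℓ x, lam ℓ x = dot2 (g ℓ) x + lam ℓ 0) (ℓ i : Fin 3) (s : ℝ) :
    lam ℓ (edgePt v i s) = (1 - s) * lam ℓ (v (i + 1)) + s * lam ℓ (v (i + 2)) := by
  rw [hlin ℓ (edgePt v i s), hlin ℓ (v (i + 1)), hlin ℓ (v (i + 2))]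
  simp only [dot2, edgePt, Pi.add_apply, Pi.smul_apply, Pi.sub_apply, smul_eq_mul]
  ring

theorem elen_sq (v : Fin 3 → V2) (i : Fin 3) :
    elen v i ^ 2 = dot2 (v (i + 2) - v (i + 1)) (v (i + 2) - v (i + 1)) :=
  Real.sq_sqrt (add_nonneg (mul_self_nonneg _) (mul_self_nonneg _))

theorem dot2_nrml (v : Fin 3 → V2) (i : Fin 3) (a : V2) :
    dot2 (nrml v i) a = (elen v i)⁻¹ * dot2 (rot (v (i + 2) - v (i + 1))) a := by
  simp only [nrml, tang, dot2, rot, cons_val_zero, cons_val_one, Pi.smul_apply, smul_eq_mul]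
  ring

theorem elen_ne_zero_s5 (hlin : ∀ ℓ x, lam ℓ x = dot2 (g ℓ) x + lam ℓ 0)
    (hvert : ∀ ℓ m, lam ℓ (v m) = if ℓ = m then 1 else 0) (i : Fin 3) : elen v i ≠ 0 := by
  intro h
  have hsq := elen_sq v i
  have hj := dot2_grad_sub hlin (i + 2) (v (i + 2)) (v (i + 1))
  have hne : i + 2 ≠ i + 1 := by fin_cases i <;> decide
  rw [hvert, hvert, if_pos rfl, if_neg hne] at hj
  rw [h] at hsq
  simp only [dot2] at hsq hj
  have h0 : (v (i + 2) - v (i + 1)) 0 = 0 := by nlinarith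
  have h1 : (v (i + 2) - v (i + 1)) 1 = 0 := by nlinarith
  rw [h0, h1] at hj
  norm_num at hj

theorem dot2_nrml_self (hL : elen v i ≠ 0) : dot2 (nrml v i) (nrml v i) = 1 := by
  have hsq := elen_sq v i
  simp only [nrml, tang, dot2, rot, cons_val_zero, cons_val_one, Pi.smul_apply, smul_eq_mul]
    at hsq ⊢
  field_simp
  linear_combination -hsq

theorem dot2_nrml_tv_edge (v : Fin 3 → V2) (i : Fin 3) :
    dot2 (nrml v i) (tv v (i + 1) (i + 2)) = 0 := by
  rw [dot2_nrml]
  simp only [tv, dot2, rot, cons_val_zero, cons_val_one]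
  ring

/-- The gradients satisfy `(c_{ij} + c_{ik}) (n_i · t_{ki})² = -1`. -/
theorem cc_add_mul_sq_height (hlin : ∀ ℓ x, lam ℓ x = dot2 (g ℓ) x + lam ℓ 0)
    (hvert : ∀ ℓ m, lam ℓ (v m) = if ℓ = m then 1 else 0) (i : Fin 3) :
    (cc g i (i + 1) + cc g i (i + 2)) * dot2 (nrml v i) (tv v (i + 2) i) ^ 2 = -1 := by
  have hL := elen_ne_zero_s5 hlin hvert i
  have hsq := elen_sq v i
  have hd : dot2 (v (i + 2) - v (i + 1)) (v (i + 2) - v (i + 1)) ≠ 0 := hsq ▸ pow_ne_zero 2 hL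
  have hgrad : ∀ ℓ m m', dot2 (g ℓ) (v m - v m') =
      (if ℓ = m then 1 else 0) - (if ℓ = m' then 1 else 0) := fun ℓ m m' => by
    rw [dot2_grad_sub hlin, hvert, hvert]
  have hgd : dot2 (g i) (v (i + 2) - v (i + 1)) = 0 := by
    rw [hgrad]; fin_cases i <;> simp
  have hga : dot2 (g i) (v i - v (i + 2)) = 1 := by
    rw [hgrad]; fin_cases i <;> simp
  have hh := dot2_self_mul_sq_dot2_rot hgd hga hd
  have hda : dot2 (rot (v (i + 2) - v (i + 1))) (v i - v (i + 2)) ≠ 0 := by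
    intro h
    rw [h] at hh
    exact hd (by linarith)
  have hsum : ∀ m m', dot2 (g i + g (i + 1) + g (i + 2)) (v m - v m') = 0 := fun m m' => by
    have h0 := hgrad i m m'
    have h1 := hgrad (i + 1) m m'
    have h2 := hgrad (i + 2) m m'
    have hone : ∀ p : Fin 3, (if i = p then (1 : ℝ) else 0) + (if i + 1 = p then 1 else 0)
        + (if i + 2 = p then 1 else 0) = 1 := by
      intro p; fin_cases i <;> fin_cases p <;> simp
    have hm := hone m
    have hm' := hone m'
    simp only [dot2, Pi.add_apply] at h0 h1 h2 ⊢
    linear_combination h0 + h1 + h2 + hm - hm'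
  have hc := dot2_eq_zero_of_orthogonal (hsum _ _) (hsum _ _) hda (g i)
  have hcc : cc g i (i + 1) + cc g i (i + 2) = -dot2 (g i) (g i) := by
    simp only [cc, dot2, Pi.add_apply] at hc ⊢
    linear_combination hc
  rw [hcc, dot2_nrml, tv]
  field_simp
  linear_combination hsq - hh

theorem psi_normal_normal (hlin : ∀ ℓ x, lam ℓ x = dot2 (g ℓ) x + lam ℓ 0)
    (hvert : ∀ ℓ m, lam ℓ (v m) = if ℓ = m then 1 else 0) (i : Fin 3) {x : V2}
    (hx : lam i x = 0) :
    dot2 (nrml v i) ((psi v lam g i x).mulVec (nrml v i)) =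
      10 * lam (i + 1) x * lam (i + 2) x ^ 2 := by
  have hheight : dot2 (nrml v i) (tv v i (i + 1)) = -dot2 (nrml v i) (tv v (i + 2) i) := by
    have h := dot2_nrml_tv_edge v i
    simp only [tv, dot2, Pi.sub_apply] at h ⊢
    linear_combination -h
  simp only [psi, dot2_mulVec_add, dot2_mulVec_smul, dot2_mulVec_ot, dot2_nrml_tv_edge, hheight, hx]
  linear_combination
    (-10 * lam (i + 1) x * lam (i + 2) x ^ 2) * cc_add_mul_sq_height hlin hvert i

theorem phi1_normal_normal (hlin : ∀ ℓ x, lam ℓ x = dot2 (g ℓ) x + lam ℓ 0)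
    (hvert : ∀ ℓ m, lam ℓ (v m) = if ℓ = m then 1 else 0) (i : Fin 3) {x : V2}
    (hx : lam i x = 0) :
    dot2 (nrml v i) ((phi1 v lam g i x).mulVec (nrml v i)) =
      36 * lam (i + 1) x * lam (i + 2) x - 60 * lam (i + 1) x * lam (i + 2) x ^ 2 := by
  rw [phi1, dot2_mulVec_sub, dot2_mulVec_smul, dot2_mulVec_smul, dot2_mulVec_ot,
    dot2_nrml_self (elen_ne_zero_s5 hlin hvert i), psi_normal_normal hlin hvert i hx]
  ring

theorem phi2_normal_normal (hlin : ∀ ℓ x, lam ℓ x = dot2 (g ℓ) x + lam ℓ 0)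
    (hvert : ∀ ℓ m, lam ℓ (v m) = if ℓ = m then 1 else 0) (i : Fin 3) {x : V2}
    (hx : lam i x = 0) :
    dot2 (nrml v i) ((phi2 v lam g i x).mulVec (nrml v i)) =
      -24 * lam (i + 1) x * lam (i + 2) x + 60 * lam (i + 1) x * lam (i + 2) x ^ 2 := by
  rw [phi2, dot2_mulVec_add, dot2_mulVec_smul, dot2_mulVec_smul, dot2_mulVec_ot,
    dot2_nrml_self (elen_ne_zero_s5 hlin hvert i), psi_normal_normal hlin hvert i hx]
  ring

theorem inv_elen_mul_edgeInt {i : Fin 3} (hL : elen v i ≠ 0) (f : V2 → ℝ) :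
    (elen v i)⁻¹ * edgeInt v i f = ∫ s in (0 : ℝ)..1, f (edgePt v i s) := by
  rw [edgeInt, intervalIntegral.integral_mul_const]
  field_simp

end Triangle

theorem integral_quartic (a b c d : ℝ) :
    ∫ s in (0 : ℝ)..1, (a * s + b * s ^ 2 + c * s ^ 3 + d * s ^ 4) =
      a / 2 + b / 3 + c / 4 + d / 5 := by
  have hderiv : ∀ s ∈ Set.uIcc (0 : ℝ) 1,
      HasDerivAt (fun s : ℝ => a / 2 * s ^ 2 + b / 3 * s ^ 3 + c / 4 * s ^ 4 + d / 5 * s ^ 5)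
        (a * s + b * s ^ 2 + c * s ^ 3 + d * s ^ 4) s := fun s _ => by
    refine (((((hasDerivAt_pow 2 s).const_mul (a / 2)).add
      ((hasDerivAt_pow 3 s).const_mul (b / 3))).add
      ((hasDerivAt_pow 4 s).const_mul (c / 4))).add
      ((hasDerivAt_pow 5 s).const_mul (d / 5))).congr_deriv ?_
    norm_num
    ring
  rw [intervalIntegral.integral_eq_sub_of_hasDerivAt hderiv
    (Continuous.intervalIntegrable (by fun_prop) _ _)]
  ring

/-- the edge-moment identities for φ_{i,1} and φ_{i,2} on the edge e_i,
with (i, j, k) = (i, i+1, i+2) a cyclic permutation of (0,1,2):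
(1/|e_i|)∫_{e_i} (nᵀφ_{i,1}n) λ_j ds = 1, (1/|e_i|)∫_{e_i} (nᵀφ_{i,1}n) λ_k ds = 0,
(1/|e_i|)∫_{e_i} (nᵀφ_{i,2}n) λ_j ds = 0, (1/|e_i|)∫_{e_i} (nᵀφ_{i,2}n) λ_k ds = 1. -/
theorem statement5 (v : Fin 3 → V2) (hv : AffineIndependent ℝ v)
    (lam : Fin 3 → V2 → ℝ) (g : Fin 3 → V2)
    (hlin : ∀ ℓ x, lam ℓ x = dot2 (g ℓ) x + lam ℓ 0)
    (hvert : ∀ ℓ m, lam ℓ (v m) = if ℓ = m then 1 else 0)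
    (i : Fin 3) :
    (elen v i)⁻¹ * edgeInt v i
      (fun x => dot2 (nrml v i) ((phi1 v lam g i x).mulVec (nrml v i)) * lam (i+1) x) = 1 ∧
    (elen v i)⁻¹ * edgeInt v i
      (fun x => dot2 (nrml v i) ((phi1 v lam g i x).mulVec (nrml v i)) * lam (i+2) x) = 0 ∧
    (elen v i)⁻¹ * edgeInt v i
      (fun x => dot2 (nrml v i) ((phi2 v lam g i x).mulVec (nrml v i)) * lam (i+1) x) = 0 ∧
    (elen v i)⁻¹ * edgeInt v i
      (fun x => dot2 (nrml v i) ((phi2 v lam g i x).mulVec (nrml v i)) * lam (i+2) x) = 1 := by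
  have hL := elen_ne_zero_s5 hlin hvert i
  have h0 : ∀ s, lam i (edgePt v i s) = 0 := fun s => by
    rw [lam_edgePt hlin, hvert, hvert]; fin_cases i <;> simp
  have h1 : ∀ s, lam (i + 1) (edgePt v i s) = 1 - s := fun s => by
    rw [lam_edgePt hlin, hvert, hvert]; fin_cases i <;> simp
  have h2 : ∀ s, lam (i + 2) (edgePt v i s) = s := fun s => by
    rw [lam_edgePt hlin, hvert, hvert]; fin_cases i <;> simp
  simp only [inv_elen_mul_edgeInt hL, phi1_normal_normal hlin hvert i (h0 _),
    phi2_normal_normal hlin hvert i (h0 _), h1, h2]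
  refine ⟨?_, ?_, ?_, ?_⟩
  · convert integral_quartic 36 (-132) 156 (-60) using 3 <;> ring
  · convert integral_quartic 0 36 (-96) 60 using 3 <;> ring
  · convert integral_quartic (-24) 108 (-144) 60 using 3 <;> ring
  · convert integral_quartic 0 (-24) 84 (-60) using 3 <;> ring
end
end
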